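/- arXiv:1401.5595 — 2 statements merged into one kernel-verified Lean document; each statement's English description precedes it below -/
import Mathlib

section
/- The two-level link kernel is a stochastic kernel: Fix an integer N ≥ 2, a real β > 0, and reals x^N_1 < x^N_2 < ⋯ < x^N_N. Then the integral, over all (x^{N−1}_1, …, x^{N−1}_{N−1}) with x^N_i < x^{N−1}_i < x^N_{i+1} for i = 1, …, N−1, of the function (Γ(Nβ/2)/Γ(β/2)^N) · ∏_{1≤i<m≤N−1} (x^{N−1}_m − x^{N−1}_i) · ∏_{i=1}^{N−1} ∏_{j=1}^N |x^N_j − x^{N−1}_i|^{β/2−1} · ∏_{1≤j<n≤N} (x^N_n − x^N_j)^{1−β} with respect to Lebesgue measure dx^{N−1}, equals 1. -/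
open MeasureTheory Real

open Polynomial in
theorem det_eval_eq_det_vandermonde_mul {m : ℕ} (y : Fin m → ℝ) (p : Fin m → ℝ[X])
    (hp : ∀ l, (p l).natDegree < m) :
    (Matrix.of fun j l => (p l).eval (y j)).det =
      (Matrix.vandermonde y).det * (Matrix.of fun k l : Fin m => (p l).coeff k).det := by
  rw [← Matrix.det_mul]
  congr 1
  ext j l
  simp only [Matrix.of_apply, Matrix.mul_apply, Matrix.vandermonde_apply]
  rw [eval_eq_sum_range' (hp l), Finset.sum_range]
  exact Finset.sum_congr rfl fun k _ => mul_comm _ _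

theorem abs_det_vandermonde {m : ℕ} (y : Fin m → ℝ) :
    |(Matrix.vandermonde y).det| = ∏ j, ∏ i ∈ Finset.Iio j, |y j - y i| := by
  rw [Matrix.det_vandermonde, Finset.abs_prod]
  simp only [Finset.abs_prod]
  exact Finset.prod_comm' (by simp)

theorem prod_prod_erase_abs_sub {m : ℕ} (y : Fin m → ℝ) :
    ∏ j, ∏ i ∈ Finset.univ.erase j, |y j - y i| =
      (∏ j, ∏ i ∈ Finset.Iio j, |y j - y i|) ^ 2 := by
  have hsplit (j : Fin m) : ∏ i ∈ Finset.univ.erase j, |y j - y i| =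
      (∏ i ∈ Finset.Iio j, |y j - y i|) * ∏ i ∈ Finset.Ioi j, |y j - y i| := by
    rw [← Finset.prod_union]
    · congr 1
      ext i
      simp [lt_or_lt_iff_ne]
    · exact Finset.disjoint_left.2 fun i hi hi' =>
        lt_asymm (Finset.mem_Iio.1 hi) (Finset.mem_Ioi.1 hi')
  simp only [hsplit, Finset.prod_mul_distrib, sq]
  congr 1
  rw [Finset.prod_comm' (t' := Finset.univ) (s' := fun i => Finset.Iio i) (by simp)]
  simp only [abs_sub_comm]

open Polynomial in
/-- The nodal polynomial of `u` followed by its quotients by the linear factors `X - u i`. -/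
noncomputable def nodalQuotients {n : ℕ} (u : Fin n → ℝ) : Fin (n + 1) → ℝ[X] :=
  Fin.cons (Lagrange.nodal Finset.univ u) fun i => Lagrange.nodal (Finset.univ.erase i) u

theorem natDegree_nodalQuotients_lt {n : ℕ} (u : Fin n → ℝ) (l : Fin (n + 1)) :
    (nodalQuotients u l).natDegree < n + 1 := by
  refine Fin.cases ?_ (fun i => ?_) l
  · simp [nodalQuotients]
  · simp only [nodalQuotients, Fin.cons_succ, Lagrange.natDegree_nodal]
    exact (Finset.card_le_univ _).trans_lt (by simp)

theorem abs_det_vandermonde_cons {n : ℕ} (a : ℝ) (u : Fin n → ℝ) :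
    |(Matrix.vandermonde (Fin.cons a u : Fin (n + 1) → ℝ)).det| =
      (∏ i, |a - u i|) * |(Matrix.vandermonde u).det| := by
  rw [Matrix.det_vandermonde, Fin.prod_univ_succ, Matrix.det_vandermonde, abs_mul,
    Fin.prod_Ioi_zero, Finset.abs_prod]
  simp only [Fin.prod_Ioi_succ, Fin.cons_zero, Fin.cons_succ, abs_sub_comm]

theorem det_eval_nodalQuotients_cons {n : ℕ} (a : ℝ) (u : Fin n → ℝ) :
    (Matrix.of fun j l => (nodalQuotients u l).eval ((Fin.cons a u : Fin (n + 1) → ℝ) j)).det =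
      (∏ i, (a - u i)) * ∏ j, ∏ i ∈ Finset.univ.erase j, (u j - u i) := by
  rw [Matrix.det_of_isUpperTriangular, Fin.prod_univ_succ]
  · simp [nodalQuotients, Lagrange.eval_nodal]
  · intro j l hlj
    obtain ⟨j, rfl⟩ := Fin.exists_succ_eq.2 (Fin.ne_zero_of_lt hlj)
    refine Fin.cases ?_ (fun i hi => ?_) l hlj
    · intro _
      simp [nodalQuotients, Lagrange.eval_nodal_at_node]
    · have hne : j ≠ i := fun h => by simp [h] at hi
      simp [nodalQuotients, Lagrange.eval_nodal_at_node, hne]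

theorem abs_det_eval_nodalQuotients {n : ℕ} (x : Fin (n + 1) → ℝ) {u : Fin n → ℝ}
    (hu : Function.Injective u) :
    |(Matrix.of fun j l => (nodalQuotients u l).eval (x j)).det| =
      |(Matrix.vandermonde x).det| * |(Matrix.vandermonde u).det| := by
  obtain ⟨a, ha⟩ := Infinite.exists_notMem_finset (Finset.univ.image u)
  have hne : ∀ i, a - u i ≠ 0 := fun i h => ha (by simp [sub_eq_zero.1 h])
  have hV : |(Matrix.vandermonde u).det| ≠ 0 :=
    abs_ne_zero.2 (Matrix.det_vandermonde_ne_zero_iff.2 hu)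
  have hA : ∏ i, |a - u i| ≠ 0 := Finset.prod_ne_zero_iff.2 fun i _ => abs_ne_zero.2 (hne i)
  have h := congrArg abs (det_eval_nodalQuotients_cons a u)
  rw [det_eval_eq_det_vandermonde_mul _ _ (natDegree_nodalQuotients_lt u), abs_mul, abs_mul,
    abs_det_vandermonde_cons, Finset.abs_prod, Finset.abs_prod] at h
  simp only [Finset.abs_prod] at h
  rw [prod_prod_erase_abs_sub, ← abs_det_vandermonde, mul_assoc] at h
  have h' := mul_left_cancel₀ hA h
  rw [sq] at h'
  rw [det_eval_eq_det_vandermonde_mul _ _ (natDegree_nodalQuotients_lt u), abs_mul,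
    mul_left_cancel₀ hV h']

theorem prod_erase_eq_prod_succAbove {n : ℕ} (j : Fin (n + 1)) (f : Fin (n + 1) → ℝ) :
    ∏ k ∈ Finset.univ.erase j, f k = ∏ i, f (j.succAbove i) := by
  rw [← Finset.compl_singleton, ← Fin.image_succAbove_univ,
    Finset.prod_image (Fin.succAbove_right_injective.injOn)]

/-- The barycentric weight coordinates of a leading coefficient `v 0` and roots `v 1, …, v n`:
the values at the nodes `x j` of the polynomial `v 0 * ∏ (X - v i)`, divided by
`∏_{k ≠ j} (x j - x k)`. -/
noncomputable def rootWeights {n : ℕ} (x v : Fin (n + 1) → ℝ) (j : Fin (n + 1)) : ℝ :=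
  (v 0 * ∏ i : Fin n, (x j - v i.succ)) / ∏ k ∈ Finset.univ.erase j, (x j - x k)

/-- Positive leading coefficients together with roots interlacing with `x`. -/
def interlacingSet {n : ℕ} (x : Fin (n + 1) → ℝ) : Set (Fin (n + 1) → ℝ) :=
  {v | 0 < v 0 ∧ ∀ i : Fin n, x i.castSucc < v i.succ ∧ v i.succ < x i.succ}

section Interlacing

variable {n : ℕ} {x : Fin (n + 1) → ℝ}

theorem prod_erase_sub_ne_zero (hx : StrictMono x) (j : Fin (n + 1)) :
    ∏ k ∈ Finset.univ.erase j, (x j - x k) ≠ 0 :=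
  Finset.prod_ne_zero_iff.2 fun _ hk =>
    sub_ne_zero.2 fun h => Finset.ne_of_mem_erase hk (hx.injective h).symm

theorem node_sub_root_div_pos (hx : StrictMono x) {u : Fin n → ℝ}
    (hu : ∀ i : Fin n, x i.castSucc < u i ∧ u i < x i.succ) (j : Fin (n + 1)) (i : Fin n) :
    0 < (x j - u i) / (x j - x (j.succAbove i)) := by
  rcases lt_or_ge i.castSucc j with h | h
  · rw [Fin.succAbove_of_castSucc_lt _ _ h]
    have h' : x i.succ ≤ x j := hx.monotone (Fin.castSucc_lt_iff_succ_le.1 h)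
    exact div_pos (by linarith [hu i]) (by linarith [hx h])
  · rw [Fin.succAbove_of_le_castSucc _ _ h]
    have h' : x j ≤ x i.castSucc := hx.monotone h
    exact div_pos_of_neg_of_neg (by linarith [hu i]) (by linarith [hu i])

theorem rootWeights_pos (hx : StrictMono x) {v : Fin (n + 1) → ℝ} (hv : v ∈ interlacingSet x)
    (j : Fin (n + 1)) : 0 < rootWeights x v j := by
  rw [rootWeights, prod_erase_eq_prod_succAbove j fun k => x j - x k, mul_div_assoc,
    ← Finset.prod_div_distrib]
  exact mul_pos hv.1 (Finset.prod_pos fun i _ =>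
    node_sub_root_div_pos hx (u := fun i => v i.succ) hv.2 j i)

theorem strictMono_tail_of_mem (hx : StrictMono x) {v : Fin (n + 1) → ℝ}
    (hv : v ∈ interlacingSet x) : StrictMono fun i : Fin n => v i.succ := by
  intro i k hik
  have h : x i.succ ≤ x k.castSucc := hx.monotone (by
    rw [Fin.le_def]; simpa using hik)
  exact ((hv.2 i).2.trans_le h).trans (hv.2 k).1

open Polynomial in
/-- The polynomial with leading coefficient `v 0` and roots `v 1, …, v n`. -/
noncomputable def rootPoly (v : Fin (n + 1) → ℝ) : ℝ[X] :=
  C (v 0) * Lagrange.nodal Finset.univ fun i : Fin n => v i.succ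

theorem eval_rootPoly (v : Fin (n + 1) → ℝ) (t : ℝ) :
    (rootPoly v).eval t = v 0 * ∏ i : Fin n, (t - v i.succ) := by
  simp [rootPoly, Lagrange.eval_nodal]

theorem degree_rootPoly_lt (v : Fin (n + 1) → ℝ) :
    (rootPoly v).degree < (Finset.univ : Finset (Fin (n + 1))).card := by
  refine Polynomial.degree_le_natDegree.trans_lt (Nat.cast_lt.2 ?_)
  refine (Polynomial.natDegree_C_mul_le _ _).trans_lt ?_
  simp [Lagrange.natDegree_nodal]

theorem coeff_rootPoly (v : Fin (n + 1) → ℝ) : (rootPoly v).coeff n = v 0 := by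
  have h := (Lagrange.nodal_monic (s := Finset.univ)
    (v := fun i : Fin n => v i.succ)).coeff_natDegree
  rw [Lagrange.natDegree_nodal, Finset.card_univ, Fintype.card_fin] at h
  rw [rootPoly, Polynomial.coeff_C_mul, h, mul_one]

theorem sum_rootWeights (hx : StrictMono x) (v : Fin (n + 1) → ℝ) :
    ∑ j, rootWeights x v j = v 0 := by
  have h := Lagrange.coeff_eq_sum (s := Finset.univ) (v := x) hx.injective.injOn
    (degree_rootPoly_lt v)
  simp only [Finset.card_univ, Fintype.card_fin, Nat.add_sub_cancel, coeff_rootPoly,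
    eval_rootPoly] at h
  exact h.symm

theorem injOn_rootWeights (hx : StrictMono x) : Set.InjOn (rootWeights x) (interlacingSet x) := by
  intro v hv w hw h
  have hpoly : rootPoly v = rootPoly w := by
    refine Polynomial.eq_of_degrees_lt_of_eval_index_eq Finset.univ hx.injective.injOn
      (degree_rootPoly_lt v) (degree_rootPoly_lt w) fun j _ => ?_
    have hj := congrFun h j
    simp only [rootWeights] at hj
    rw [eval_rootPoly, eval_rootPoly]
    exact (div_left_inj' (prod_erase_sub_ne_zero hx j)).1 hj
  have h0 : v 0 = w 0 := by rw [← coeff_rootPoly v, hpoly, coeff_rootPoly]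
  funext j
  refine Fin.cases h0 (fun i => ?_) j
  have hroot : (rootPoly w).eval (v i.succ) = 0 := by
    rw [← hpoly, eval_rootPoly, Finset.prod_eq_zero (Finset.mem_univ i) (sub_self _), mul_zero]
  rw [eval_rootPoly, mul_eq_zero, or_iff_right hw.1.ne', Finset.prod_eq_zero_iff] at hroot
  obtain ⟨k, -, hk⟩ := hroot
  have hk := sub_eq_zero.1 hk
  suffices i = k by rw [hk, this]
  have h1 : i.castSucc < k.succ := hx.lt_iff_lt.1 ((hv.2 i).1.trans (hk ▸ (hw.2 k).2))
  have h2 : k.castSucc < i.succ := hx.lt_iff_lt.1 ((hw.2 k).1.trans (hk ▸ (hv.2 i).2))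
  simp only [Fin.lt_def, Fin.val_castSucc, Fin.val_succ] at h1 h2
  exact Fin.ext (by omega)

theorem prod_erase_mul_prod_erase_neg (hx : StrictMono x) (i : Fin n) :
    (∏ k ∈ Finset.univ.erase i.castSucc, (x i.castSucc - x k)) *
      (∏ k ∈ Finset.univ.erase i.succ, (x i.succ - x k)) < 0 := by
  have hmid (k : Fin n) : x k.castSucc < (x k.castSucc + x k.succ) / 2 ∧
      (x k.castSucc + x k.succ) / 2 < x k.succ := by
    have := hx (Fin.castSucc_lt_succ (i := k))
    constructor <;> linarith
  set v : Fin (n + 1) → ℝ := Fin.cons 1 fun k => (x k.castSucc + x k.succ) / 2 with hvdef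
  have hv : v ∈ interlacingSet x := ⟨by simp [hvdef], fun k => by simpa [hvdef] using hmid k⟩
  have hprod : (rootPoly v).eval (x i.castSucc) * (rootPoly v).eval (x i.succ) < 0 := by
    simp only [eval_rootPoly]
    rw [mul_mul_mul_comm, ← Finset.prod_mul_distrib,
      ← Finset.mul_prod_erase _ _ (Finset.mem_univ i)]
    refine mul_neg_of_pos_of_neg (mul_pos hv.1 hv.1) (mul_neg_of_neg_of_pos ?_ ?_)
    · exact mul_neg_of_neg_of_pos (by linarith [hv.2 i]) (by linarith [hv.2 i])
    · refine Finset.prod_pos fun k hk => ?_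
      rcases lt_or_gt_of_ne (Finset.ne_of_mem_erase hk) with h | h
      · have h1 : x k.succ ≤ x i.castSucc := hx.monotone (by rw [Fin.le_def]; simpa using h)
        have h2 := hx (Fin.castSucc_lt_succ (i := i))
        exact mul_pos (by linarith [hv.2 k]) (by linarith [hv.2 k])
      · have h1 : x i.succ ≤ x k.castSucc := hx.monotone (by rw [Fin.le_def]; simpa using h)
        have h2 := hx (Fin.castSucc_lt_succ (i := i))
        exact mul_pos_of_neg_of_neg (by linarith [hv.2 k]) (by linarith [hv.2 k])
  have hw := mul_pos (rootWeights_pos hx hv i.castSucc) (rootWeights_pos hx hv i.succ)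
  rw [rootWeights, rootWeights, ← eval_rootPoly, ← eval_rootPoly, div_mul_div_comm] at hw
  rcases div_pos_iff.1 hw with h | h
  · exact absurd h.1 hprod.not_gt
  · exact h.2

theorem surjOn_rootWeights (hx : StrictMono x) :
    Set.SurjOn (rootWeights x) (interlacingSet x) (Set.univ.pi fun _ => Set.Ioi 0) := by
  intro w hw
  have hw (j : Fin (n + 1)) : 0 < w j := hw j (Set.mem_univ j)
  set p := Lagrange.interpolate Finset.univ x
    fun j => w j * ∏ k ∈ Finset.univ.erase j, (x j - x k) with hp
  have hpdeg : p.degree < (Finset.univ : Finset (Fin (n + 1))).card :=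
    Lagrange.degree_interpolate_lt _ hx.injective.injOn
  have hpx (j : Fin (n + 1)) : p.eval (x j) = w j * ∏ k ∈ Finset.univ.erase j, (x j - x k) :=
    Lagrange.eval_interpolate_at_node _ hx.injective.injOn (Finset.mem_univ j)
  have hroot (i : Fin n) : ∃ t, (x i.castSucc < t ∧ t < x i.succ) ∧ p.eval t = 0 := by
    have hneg : p.eval (x i.castSucc) * p.eval (x i.succ) < 0 := by
      rw [hpx, hpx, mul_mul_mul_comm]
      exact mul_neg_of_pos_of_neg (mul_pos (hw _) (hw _)) (prod_erase_mul_prod_erase_neg hx i)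
    have hle := (hx (Fin.castSucc_lt_succ (i := i))).le
    rcases mul_neg_iff.1 hneg with h | h
    · obtain ⟨t, ht, h0⟩ := intermediate_value_Ioo' hle p.continuous.continuousOn ⟨h.2, h.1⟩
      exact ⟨t, ht, h0⟩
    · obtain ⟨t, ht, h0⟩ := intermediate_value_Ioo hle p.continuous.continuousOn ⟨h.1, h.2⟩
      exact ⟨t, ht, h0⟩
  choose u hu hu0 using hroot
  have hlast (i : Fin n) : 0 < x (Fin.last n) - u i :=
    sub_pos.2 ((hu i).2.trans_le (hx.monotone (Fin.le_last _)))
  have hA : 0 < ∏ i, (x (Fin.last n) - u i) := Finset.prod_pos fun i _ => hlast i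
  have hpl : 0 < p.eval (x (Fin.last n)) := by
    rw [hpx]
    refine mul_pos (hw _) (Finset.prod_pos fun k hk => sub_pos.2 (hx ?_))
    exact lt_of_le_of_ne (Fin.le_last k) (Finset.ne_of_mem_erase hk)
  set v : Fin (n + 1) → ℝ :=
    Fin.cons (p.eval (x (Fin.last n)) / ∏ i, (x (Fin.last n) - u i)) u with hvdef
  have hv : v ∈ interlacingSet x := ⟨div_pos hpl hA, hu⟩
  have hinj : Function.Injective (Fin.cons (x (Fin.last n)) u : Fin (n + 1) → ℝ) := by
    refine Fin.cons_injective_iff.2 ⟨?_, (strictMono_tail_of_mem hx hv).injective⟩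
    rintro ⟨i, hi⟩
    exact (hlast i).ne' (by rw [hi, sub_self])
  have hpv : rootPoly v = p := by
    refine Polynomial.eq_of_degrees_lt_of_eval_index_eq Finset.univ hinj.injOn
      (degree_rootPoly_lt v) hpdeg fun j _ => ?_
    rw [eval_rootPoly]
    refine Fin.cases ?_ (fun i => ?_) j
    · simp only [hvdef, Fin.cons_zero, Fin.cons_succ]
      exact div_mul_cancel₀ _ hA.ne'
    · simp only [Fin.cons_succ, hu0]
      rw [Finset.prod_eq_zero (Finset.mem_univ i), mul_zero]
      simp [hvdef]
  refine ⟨v, hv, funext fun j => ?_⟩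
  rw [rootWeights, ← eval_rootPoly, hpv, hpx, mul_div_cancel_right₀ _ (prod_erase_sub_ne_zero hx j)]

theorem image_rootWeights (hx : StrictMono x) :
    rootWeights x '' interlacingSet x = Set.univ.pi fun _ => Set.Ioi 0 :=
  (surjOn_rootWeights hx).image_eq_of_mapsTo fun _ hv j _ => rootWeights_pos hx hv j

/-- The Jacobian matrix of `rootWeights x` at `v`. -/
noncomputable def rootWeightsJacobian (x v : Fin (n + 1) → ℝ) :
    Matrix (Fin (n + 1)) (Fin (n + 1)) ℝ :=
  Matrix.of fun j l => (∏ k ∈ Finset.univ.erase j, (x j - x k))⁻¹ *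
    ((Fin.cons 1 fun _ => -v 0 : Fin (n + 1) → ℝ) l *
      (nodalQuotients (fun i : Fin n => v i.succ) l).eval (x j))

theorem hasFDerivAt_rootWeights (x v : Fin (n + 1) → ℝ) :
    HasFDerivAt (rootWeights x)
      (LinearMap.toContinuousLinearMap (Matrix.toLin' (rootWeightsJacobian x v))) v := by
  rw [hasFDerivAt_pi']
  intro j
  have hproj (l : Fin (n + 1)) : HasFDerivAt (fun w : Fin (n + 1) → ℝ => w l)
      (ContinuousLinearMap.proj l : (Fin (n + 1) → ℝ) →L[ℝ] ℝ) v := hasFDerivAt_apply l v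
  have hprod := HasFDerivAt.finsetProd (u := Finset.univ) (x := v)
    fun (i : Fin n) _ => (hproj i.succ).const_sub (x j)
  have h := ((hproj 0).mul hprod).mul_const (∏ k ∈ Finset.univ.erase j, (x j - x k))⁻¹
  refine h.congr_fderiv ?_
  ext w
  simp [rootWeightsJacobian, Matrix.mulVec, dotProduct, Fin.sum_univ_succ, nodalQuotients,
    Lagrange.eval_nodal, Finset.mul_sum]
  simp only [mul_assoc, add_comm]

theorem abs_det_rootWeightsJacobian (hx : StrictMono x) {v : Fin (n + 1) → ℝ}
    (hv : v ∈ interlacingSet x) :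
    |(rootWeightsJacobian x v).det| =
      v 0 ^ n * (∏ m : Fin n, ∏ i ∈ Finset.Iio m, (v m.succ - v i.succ)) *
        (∏ j, ∏ i ∈ Finset.Iio j, (x j - x i))⁻¹ := by
  have hx' : ∏ j, ∏ i ∈ Finset.Iio j, |x j - x i| = ∏ j, ∏ i ∈ Finset.Iio j, (x j - x i) :=
    Finset.prod_congr rfl fun j _ => Finset.prod_congr rfl fun i hi =>
      abs_of_pos (sub_pos.2 (hx (Finset.mem_Iio.1 hi)))
  have hu := strictMono_tail_of_mem hx hv
  have hu' : ∏ m : Fin n, ∏ i ∈ Finset.Iio m, |v m.succ - v i.succ| =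
      ∏ m : Fin n, ∏ i ∈ Finset.Iio m, (v m.succ - v i.succ) :=
    Finset.prod_congr rfl fun j _ => Finset.prod_congr rfl fun i hi =>
      abs_of_pos (sub_pos.2 (hu (Finset.mem_Iio.1 hi)))
  have hV : ∏ j, ∏ i ∈ Finset.Iio j, (x j - x i) ≠ 0 :=
    (Finset.prod_pos fun j _ => Finset.prod_pos fun i hi =>
      sub_pos.2 (hx (Finset.mem_Iio.1 hi))).ne'
  have hdet : (rootWeightsJacobian x v).det =
      (∏ j, (∏ k ∈ Finset.univ.erase j, (x j - x k))⁻¹) *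
        ((∏ l, (Fin.cons 1 fun _ => -v 0 : Fin (n + 1) → ℝ) l) *
          (Matrix.of fun j l =>
            (nodalQuotients (fun i : Fin n => v i.succ) l).eval (x j)).det) := by
    rw [← Matrix.det_mul_row, ← Matrix.det_mul_column]
    rfl
  have hc : |∏ l, (Fin.cons 1 fun _ => -v 0 : Fin (n + 1) → ℝ) l| = v 0 ^ n := by
    simp [Fin.prod_univ_succ, abs_of_pos hv.1]
  rw [hdet, abs_mul, abs_mul, hc, abs_det_eval_nodalQuotients x hu.injective, abs_det_vandermonde,
    abs_det_vandermonde, hx', hu', Finset.abs_prod]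
  simp only [abs_inv, Finset.abs_prod, Finset.prod_inv_distrib, prod_prod_erase_abs_sub, hx']
  field_simp

theorem measurableSet_interlacingSet (x : Fin (n + 1) → ℝ) :
    MeasurableSet (interlacingSet x) := by
  unfold interlacingSet
  measurability

theorem setIntegral_rootWeights (hx : StrictMono x) (g : (Fin (n + 1) → ℝ) → ℝ) :
    ∫ w in Set.univ.pi fun _ => Set.Ioi 0, g w =
      ∫ v in interlacingSet x, |(rootWeightsJacobian x v).det| * g (rootWeights x v) := by
  rw [← image_rootWeights hx, integral_image_eq_integral_abs_det_fderiv_smul volume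
    (measurableSet_interlacingSet x)
    (fun v _ => (hasFDerivAt_rootWeights x v).hasFDerivWithinAt) (injOn_rootWeights hx)]
  simp only [ContinuousLinearMap.det, LinearMap.coe_toContinuousLinearMap, LinearMap.det_toLin',
    smul_eq_mul]

theorem setIntegral_interlacingSet (x : Fin (n + 1) → ℝ) (f : ℝ → ℝ) (g : (Fin n → ℝ) → ℝ) :
    ∫ v in interlacingSet x, f (v 0) * g (fun i => v i.succ) =
      (∫ r in Set.Ioi 0, f r) *
        ∫ u in {u | ∀ i : Fin n, x i.castSucc < u i ∧ u i < x i.succ}, g u := by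
  rw [← setIntegral_prod_mul, ← Measure.volume_eq_prod,
    ← (volume_preserving_piFinSuccAbove (fun _ : Fin (n + 1) => ℝ) 0).setIntegral_preimage_emb
      (MeasurableEquiv.measurableEmbedding _)]
  rfl

theorem setIntegral_pi_Ioi_gamma {s : ℝ} (hs : 0 < s) :
    ∫ w in Set.univ.pi fun _ : Fin (n + 1) => Set.Ioi (0 : ℝ),
      ∏ j, (Real.exp (-w j) * w j ^ (s - 1)) = Real.Gamma s ^ (n + 1) := by
  rw [volume_pi, Measure.restrict_pi_pi, integral_fintype_prod_eq_pow
    (f := fun t : ℝ => Real.exp (-t) * t ^ (s - 1)), ← Real.Gamma_eq_integral hs, Fintype.card_fin]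

theorem prod_rootWeights_rpow (hx : StrictMono x) {v : Fin (n + 1) → ℝ}
    (hv : v ∈ interlacingSet x) (a : ℝ) :
    ∏ j, rootWeights x v j ^ a = v 0 ^ ((n + 1) * a) *
      (∏ i : Fin n, ∏ j, |x j - v i.succ| ^ a) *
        (∏ j, ∏ i ∈ Finset.Iio j, (x j - x i)) ^ (-2 * a) := by
  have hx' : ∏ j, ∏ i ∈ Finset.Iio j, |x j - x i| = ∏ j, ∏ i ∈ Finset.Iio j, (x j - x i) :=
    Finset.prod_congr rfl fun j _ => Finset.prod_congr rfl fun i hi =>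
      abs_of_pos (sub_pos.2 (hx (Finset.mem_Iio.1 hi)))
  have hV : 0 < ∏ j, ∏ i ∈ Finset.Iio j, (x j - x i) :=
    Finset.prod_pos fun j _ => Finset.prod_pos fun i hi =>
      sub_pos.2 (hx (Finset.mem_Iio.1 hi))
  have habs (j : Fin (n + 1)) : rootWeights x v j =
      v 0 * (∏ i : Fin n, |x j - v i.succ|) / ∏ k ∈ Finset.univ.erase j, |x j - x k| := by
    rw [← abs_of_pos (rootWeights_pos hx hv j), rootWeights, abs_div, abs_mul, abs_of_pos hv.1,
      Finset.abs_prod, Finset.abs_prod]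
  have hprod : ∏ j, rootWeights x v j = v 0 ^ (n + 1) * (∏ i : Fin n, ∏ j, |x j - v i.succ|) /
      (∏ j, ∏ i ∈ Finset.Iio j, (x j - x i)) ^ 2 := by
    simp only [habs, Finset.prod_div_distrib, Finset.prod_mul_distrib, prod_prod_erase_abs_sub,
      hx', Finset.prod_const, Finset.card_univ, Fintype.card_fin]
    rw [Finset.prod_comm]
  have hP : 0 ≤ ∏ i : Fin n, ∏ j, |x j - v i.succ| :=
    Finset.prod_nonneg fun i _ => Finset.prod_nonneg fun j _ => abs_nonneg _
  have hv0 := hv.1.le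
  rw [Real.finsetProd_rpow _ _ fun j _ => (rootWeights_pos hx hv j).le, hprod,
    Real.div_rpow (by positivity) (by positivity), Real.mul_rpow (by positivity) hP,
    ← Real.rpow_natCast, ← Real.rpow_natCast, ← Real.rpow_mul hv0, ← Real.rpow_mul hV.le,
    div_eq_mul_inv, ← Real.rpow_neg hV.le, ← Real.finsetProd_rpow _ _ fun i _ =>
      Finset.prod_nonneg fun j _ => abs_nonneg _]
  simp only [Real.finsetProd_rpow _ _ fun j _ => abs_nonneg _]
  push_cast
  rw [neg_mul]

end Interlacing

/-- **The two-level link kernel is a stochastic kernel.** For `N = n+1 ≥ 2`, `β > 0` and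
`x_1 < ⋯ < x_N`, the integral over all `(u_1,…,u_{N−1})` with `x_i < u_i < x_{i+1}` of
`(Γ(Nβ/2)/Γ(β/2)^N) ∏_{i<m}(u_m−u_i) ∏_{i=1}^{N−1}∏_{j=1}^N |x_j−u_i|^{β/2−1}
  ∏_{j<n'}(x_{n'}−x_j)^{1−β}` equals `1`. -/
theorem link_kernel_is_stochastic (n : ℕ) (hn : 1 ≤ n) (β : ℝ) (hβ : 0 < β)
    (x : Fin (n + 1) → ℝ) (hx : StrictMono x) :
    (∫ u : Fin n → ℝ in {u | ∀ i : Fin n, x i.castSucc < u i ∧ u i < x i.succ},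
      Real.Gamma (((n : ℝ) + 1) * (β / 2)) / Real.Gamma (β / 2) ^ (n + 1) *
        (∏ m : Fin n, ∏ i ∈ Finset.Iio m, (u m - u i)) *
        (∏ i : Fin n, ∏ j : Fin (n + 1), |x j - u i| ^ (β / 2 - 1)) *
        ∏ j : Fin (n + 1), ∏ i ∈ Finset.Iio j, (x j - x i) ^ (1 - β))
    = 1 := by
  set s := β / 2 with hs
  have hs0 : 0 < s := half_pos hβ
  have hns : 0 < ((n : ℝ) + 1) * s := by positivity
  have hsub (j : Fin (n + 1)) : ∀ i ∈ Finset.Iio j, 0 < x j - x i := fun i hi =>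
    sub_pos.2 (hx (Finset.mem_Iio.1 hi))
  have hV : 0 < ∏ j, ∏ i ∈ Finset.Iio j, (x j - x i) :=
    Finset.prod_pos fun j _ => Finset.prod_pos (hsub j)
  have hVpow : ∏ j, ∏ i ∈ Finset.Iio j, (x j - x i) ^ (1 - β) =
      (∏ j, ∏ i ∈ Finset.Iio j, (x j - x i))⁻¹ *
        (∏ j, ∏ i ∈ Finset.Iio j, (x j - x i)) ^ (-2 * (s - 1)) := by
    rw [← Real.rpow_neg_one (∏ j, ∏ i ∈ Finset.Iio j, (x j - x i)), ← Real.rpow_add hV,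
      ← Real.finsetProd_rpow _ _ fun j _ => Finset.prod_nonneg fun i hi => (hsub j i hi).le]
    refine Finset.prod_congr rfl fun j _ => ?_
    rw [← Real.finsetProd_rpow _ _ fun i hi => (hsub j i hi).le, hs]
    ring_nf
  set kernel : (Fin n → ℝ) → ℝ := fun u =>
    (∏ m : Fin n, ∏ i ∈ Finset.Iio m, (u m - u i)) *
      (∏ i : Fin n, ∏ j : Fin (n + 1), |x j - u i| ^ (s - 1)) *
        ∏ j : Fin (n + 1), ∏ i ∈ Finset.Iio j, (x j - x i) ^ (1 - β) with hkernel
  have key : Real.Gamma s ^ (n + 1) = Real.Gamma (((n : ℝ) + 1) * s) *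
      ∫ u in {u | ∀ i : Fin n, x i.castSucc < u i ∧ u i < x i.succ}, kernel u := by
    rw [← setIntegral_pi_Ioi_gamma hs0, setIntegral_rootWeights hx, Real.Gamma_eq_integral hns,
      ← setIntegral_interlacingSet]
    refine setIntegral_congr_fun (measurableSet_interlacingSet x) fun v hv => ?_
    have hr : v 0 ^ (((n : ℝ) + 1) * s - 1) = v 0 ^ n * v 0 ^ (((n : ℝ) + 1) * (s - 1)) := by
      rw [← Real.rpow_natCast, ← Real.rpow_add hv.1]
      ring_nf
    simp only [hkernel, Finset.prod_mul_distrib, ← Real.exp_sum, Finset.sum_neg_distrib,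
      sum_rootWeights hx, prod_rootWeights_rpow hx hv, abs_det_rootWeightsJacobian hx hv, hVpow, hr]
    ring
  have hG : Real.Gamma s ^ (n + 1) ≠ 0 := pow_ne_zero _ (Real.Gamma_pos_of_pos hs0).ne'
  calc _ = ∫ u in {u | ∀ i : Fin n, x i.castSucc < u i ∧ u i < x i.succ},
        Real.Gamma (((n : ℝ) + 1) * s) / Real.Gamma s ^ (n + 1) * kernel u := by
        simp only [hkernel, mul_assoc]
    _ = 1 := by rw [integral_const_mul, div_mul_eq_mul_div, ← key, div_self hG]
end

section
/- Diffusive limit of the Jack measure weights (fixed-time convergence to the Hermite β ensemble density): Fix an integer N ≥ 1, reals θ > 0 and t > 0, and a point y in the open Weyl chamber W^N = {y ∈ ℝ^N : y_1 < ⋯ < y_N}. For a partition λ with at most N rows (a nonincreasing sequence of nonnegative integers λ_1 ≥ ⋯ ≥ λ_N ≥ 0, with transpose λ'_j = #{i : λ_i ≥ j} and |λ| = Σ_i λ_i) and ε > 0, define the weight W_ε(λ) := exp(−N t/ε) · (t/ε)^{|λ|} · ∏_{(i,j): 1≤i≤N, 1≤j≤λ_i} [ Nθ + (j−1) − θ(i−1)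 ] / [ (λ_i − j + θ(λ'_j − i) + θ)(λ_i − j + θ(λ'_j − i) + 1) ]. Then for every sequence ε_n → 0+ and every sequence of partitions λ(n) with at most N rows such that ε_n^{1/2}(λ_i(n) − t/ε_n) → y_{N+1−i} for each i = 1, …, N, one has lim_{n→∞} ε_n^{−N/2} W_{ε_n}(λ(n)) = (1/Z) · ∏_{1≤i<j≤N} (y_j − y_i)^{2θ} · ∏_{i=1}^N exp(−y_i²/(2t)), where Z = t^{θN(N−1)/2 + N/2} (2π)^{N/2} ∏_{j=1}^N Γ(jθ)/Γ(θ). -/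
open Filter Real

/-- The column counts (transposed diagram) of a partition given by its row lengths:
`λ'_j = #{i : λ_i ≥ j}`. -/
def transposeCount {N : ℕ} (lam : Fin N → ℕ) (j : ℕ) : ℕ :=
  (Finset.univ.filter (fun i : Fin N => j ≤ lam i)).card

/-- The Jack measure weight `W_ε(λ) = exp(−Nt/ε) (t/ε)^{|λ|}
∏_{(i,j)∈λ} [Nθ + (j−1) − θ(i−1)] / [(λ_i−j+θ(λ'_j−i)+θ)(λ_i−j+θ(λ'_j−i)+1)]`,
written with 0-based row index `i : Fin N` and 0-based column index `j ∈ range (λ_i)`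
(so the paper's `(i,j)` is `(i+1, j+1)` here). -/
noncomputable def jackWeight (N : ℕ) (θ t ε : ℝ) (lam : Fin N → ℕ) : ℝ :=
  Real.exp (-((N : ℝ) * t / ε)) * (t / ε) ^ (∑ i, lam i) *
    ∏ i : Fin N, ∏ j ∈ Finset.range (lam i),
      ((N : ℝ) * θ + (j : ℝ) - θ * (i : ℝ)) /
        (((lam i : ℝ) - ((j : ℝ) + 1) +
            θ * ((transposeCount lam (j + 1) : ℝ) - ((i : ℝ) + 1)) + θ) *
          ((lam i : ℝ) - ((j : ℝ) + 1) +
            θ * ((transposeCount lam (j + 1) : ℝ) - ((i : ℝ) + 1)) + 1))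

/-- The sequence of row lengths of a partition, continued by zeros. -/
def extendRows {N : ℕ} (lam : Fin N → ℕ) (k : ℕ) : ℕ :=
  if h : k < N then lam ⟨k, h⟩ else 0

theorem extendRows_of_lt {N : ℕ} (lam : Fin N → ℕ) {k : ℕ} (h : k < N) :
    extendRows lam k = lam ⟨k, h⟩ := by
  simp [extendRows, h]

theorem extendRows_antitone {N : ℕ} {lam : Fin N → ℕ} (hlam : Antitone lam) :
    Antitone (extendRows lam) := by
  intro a b hab
  unfold extendRows
  split_ifs with hb ha ha
  · exact hlam (by simpa using hab)
  · omega
  · exact Nat.zero_le _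
  · exact le_rfl

theorem transposeCount_eq {N : ℕ} {lam : Fin N → ℕ} (hlam : Antitone lam) {m j : ℕ}
    (hm : m < N) (h1 : extendRows lam (m + 1) ≤ j) (h2 : j < extendRows lam m) :
    transposeCount lam (j + 1) = m + 1 := by
  have : (Finset.univ.filter fun i : Fin N => j + 1 ≤ lam i) = Finset.Iic ⟨m, hm⟩ := by
    ext i
    have hi : extendRows lam i = lam i := extendRows_of_lt lam i.2
    simp only [Finset.mem_filter, Finset.mem_univ, true_and, Finset.mem_Iic, Fin.le_def]
    constructor
    · intro h
      by_contra! hlt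
      have := extendRows_antitone hlam (show m + 1 ≤ (i : ℕ) from hlt)
      omega
    · intro h
      have := extendRows_antitone hlam h
      omega
  rw [transposeCount, this, Fin.card_Iic]

theorem prod_Ico_sub_eq_Gamma_div {a b : ℕ} (hab : a ≤ b) (x : ℝ) (hx : 0 < x - b) :
    ∏ j ∈ Finset.Ico a b, (x - ((j : ℝ) + 1)) = Gamma (x - a) / Gamma (x - b) := by
  induction b, hab using Nat.le_induction with
  | base => simp [(Gamma_pos_of_pos hx).ne']
  | succ b hab ih =>
    push_cast at hx ⊢
    rw [Finset.prod_Ico_succ_top hab, ih (by linarith)]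
    have h : Gamma (x - b) = (x - (b + 1)) * Gamma (x - (b + 1)) := by
      rw [← Gamma_add_one hx.ne']
      congr 1
      ring
    rw [h]
    have := (Gamma_pos_of_pos hx).ne'
    field_simp

theorem prod_range_add_eq_Gamma_div {a : ℝ} (ha : 0 < a) (n : ℕ) :
    ∏ j ∈ Finset.range n, (a + (j : ℝ)) = Gamma (n + a) / Gamma a := by
  have := (Gamma_pos_of_pos ha).ne'
  induction n with
  | zero => simp [this]
  | succ n ih =>
    rw [Finset.prod_range_succ, ih]
    have h : (((n + 1 : ℕ) : ℝ) + a) = (n + a) + 1 := by push_cast; ring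
    rw [h, Gamma_add_one (by positivity)]
    field_simp
    ring

theorem prod_hook_Ico {N : ℕ} {lam : Fin N → ℕ} (hlam : Antitone lam) {θ c : ℝ} (hθ : 0 < θ)
    (hc : 0 < c) {i m : ℕ} (him : i ≤ m) (hm : m ≤ N) :
    ∏ j ∈ Finset.Ico (extendRows lam m) (extendRows lam i),
      ((extendRows lam i : ℝ) - ((j : ℝ) + 1) +
        θ * ((transposeCount lam (j + 1) : ℝ) - ((i : ℝ) + 1)) + c) =
      Gamma ((extendRows lam i : ℝ) - extendRows lam m + θ * ((m : ℝ) - i) + c) / Gamma c *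
        ∏ k ∈ Finset.Ioc i m,
          Gamma ((extendRows lam i : ℝ) - extendRows lam k + θ * ((k : ℝ) - 1 - i) + c) /
            Gamma ((extendRows lam i : ℝ) - extendRows lam k + θ * ((k : ℝ) - i) + c) := by
  have hmu := extendRows_antitone hlam
  have hpos : ∀ k : ℕ, i ≤ k → 0 <
      (extendRows lam i : ℝ) - extendRows lam k + θ * ((k : ℝ) - i) + c := by
    intro k hk
    have h1 : (extendRows lam k : ℝ) ≤ extendRows lam i := by exact_mod_cast hmu hk
    have h2 : (i : ℝ) ≤ k := by exact_mod_cast hk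
    have := mul_nonneg hθ.le (sub_nonneg.2 h2)
    linarith
  induction m, him using Nat.le_induction with
  | base => simp [(Gamma_pos_of_pos hc).ne']
  | succ m him ih =>
    have hblock : ∏ j ∈ Finset.Ico (extendRows lam (m + 1)) (extendRows lam m),
        ((extendRows lam i : ℝ) - ((j : ℝ) + 1) +
          θ * ((transposeCount lam (j + 1) : ℝ) - ((i : ℝ) + 1)) + c) =
        Gamma ((extendRows lam i : ℝ) - extendRows lam (m + 1) + θ * ((m : ℝ) - i) + c) /
          Gamma ((extendRows lam i : ℝ) - extendRows lam m + θ * ((m : ℝ) - i) + c) := by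
      have h := prod_Ico_sub_eq_Gamma_div (hmu m.le_succ)
        ((extendRows lam i : ℝ) + θ * ((m : ℝ) - i) + c) (by linarith [hpos m him])
      rw [show (extendRows lam i : ℝ) - extendRows lam (m + 1) + θ * ((m : ℝ) - i) + c =
        (extendRows lam i : ℝ) + θ * ((m : ℝ) - i) + c - extendRows lam (m + 1) by ring,
        show (extendRows lam i : ℝ) - extendRows lam m + θ * ((m : ℝ) - i) + c =
        (extendRows lam i : ℝ) + θ * ((m : ℝ) - i) + c - extendRows lam m by ring, ← h]
      refine Finset.prod_congr rfl fun j hj => ?_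
      rw [Finset.mem_Ico] at hj
      rw [transposeCount_eq hlam (by omega) hj.1 hj.2]
      push_cast
      ring
    rw [← Finset.prod_Ico_consecutive _ (hmu m.le_succ) (hmu him), hblock, ih (by omega),
      Finset.prod_Ioc_succ_top (by omega)]
    have h1 := (Gamma_pos_of_pos (hpos m him)).ne'
    have h2 := (Gamma_pos_of_pos (hpos (m + 1) (by omega))).ne'
    push_cast at h2 ⊢
    rw [show ((m : ℝ) + 1 - 1 - i) = (m : ℝ) - i by ring]
    field_simp

theorem prod_hook_row {N : ℕ} {lam : Fin N → ℕ} (hlam : Antitone lam) {θ c : ℝ} (hθ : 0 < θ)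
    (hc : 0 < c) (i : Fin N) :
    ∏ j ∈ Finset.range (lam i),
      ((lam i : ℝ) - ((j : ℝ) + 1) +
        θ * ((transposeCount lam (j + 1) : ℝ) - ((i : ℝ) + 1)) + c) =
      Gamma ((lam i : ℝ) + θ * ((N : ℝ) - 1 - i) + c) / Gamma c *
        ∏ k ∈ Finset.Ioi i,
          Gamma ((lam i : ℝ) - lam k + θ * ((k : ℝ) - 1 - i) + c) /
            Gamma ((lam i : ℝ) - lam k + θ * ((k : ℝ) - i) + c) := by
  have h := prod_hook_Ico hlam hθ hc i.2.le le_rfl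
  have hN0 : extendRows lam N = 0 := by simp [extendRows]
  rw [hN0, extendRows_of_lt lam i.2, Nat.Ico_zero_eq_range] at h
  simp only [Fin.eta] at h
  rw [h]
  have hlast : Finset.Ioc (i : ℕ) N = insert N (Finset.Ioc (i : ℕ) (N - 1)) := by
    ext k
    have := i.2
    simp only [Finset.mem_Ioc, Finset.mem_insert]
    omega
  have hfin : Finset.Ioc (i : ℕ) (N - 1) = (Finset.Ioi i).map Fin.valEmbedding := by
    ext k
    simp only [Finset.mem_Ioc, Finset.mem_map, Finset.mem_Ioi, Fin.valEmbedding_apply]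
    constructor
    · rintro ⟨h1, h2⟩
      exact ⟨⟨k, by omega⟩, by simpa [Fin.lt_def] using h1, rfl⟩
    · rintro ⟨a, ha, rfl⟩
      have := a.2
      rw [Fin.lt_def] at ha
      omega
  rw [hlast, Finset.prod_insert (by have := i.2; simp; omega), hfin, Finset.prod_map]
  have hk : ∀ k : Fin N, extendRows lam (k : ℕ) = lam k :=
    fun k => extendRows_of_lt lam k.2
  simp only [hk, hN0, Fin.valEmbedding_apply, Nat.cast_zero, sub_zero]
  have hiN : (i : ℝ) < N := by exact_mod_cast i.2
  have hne : Gamma ((lam i : ℝ) + θ * ((N : ℝ) - i) + c) ≠ 0 := by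
    have := mul_pos hθ (sub_pos.2 hiN)
    exact (Gamma_pos_of_pos (by positivity)).ne'
  field_simp

theorem tendsto_Gamma_div_factorial {s : ℝ} (hs : 0 < s) :
    Tendsto (fun n : ℕ => Gamma (n + s) / ((n : ℝ) ^ (s - 1) * (n.factorial : ℝ))) atTop
      (nhds 1) := by
  have hG := (Gamma_pos_of_pos hs).ne'
  have h1 := (tendsto_const_nhds (x := Gamma s)).div (GammaSeq_tendsto_Gamma s) hG
  rw [div_self hG] at h1
  have h2 : Tendsto (fun n : ℕ => (n : ℝ) / (n + s)) atTop (nhds 1) :=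
    tendsto_natCast_div_add_atTop s
  have h3 := h1.mul h2
  rw [one_mul] at h3
  refine h3.congr' ?_
  filter_upwards [eventually_gt_atTop 0] with n hn
  have hn' : (0 : ℝ) < n := by exact_mod_cast hn
  have hp := prod_range_add_eq_Gamma_div hs (n + 1)
  rw [show (((n + 1 : ℕ) : ℝ) + s) = (n + s) + 1 by push_cast; ring,
    Gamma_add_one (by positivity)] at hp
  have hns : (n : ℝ) + s ≠ 0 := by positivity
  have hr : (n : ℝ) ^ (s - 1) = (n : ℝ) ^ s / n := by
    rw [rpow_sub hn', rpow_one]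
  have hp0 : (n : ℝ) ^ s ≠ 0 := (rpow_pos_of_pos hn' s).ne'
  have hf : (n.factorial : ℝ) ≠ 0 := by positivity
  simp only [Pi.div_apply]
  rw [GammaSeq, hp, hr]
  field_simp

theorem tendsto_Gamma_shift_div {s b : ℝ} (hs : 0 < s) (hb : 0 < s + b) :
    Tendsto (fun n : ℕ => Gamma (n + (s + b)) / Gamma (n + s) / (n : ℝ) ^ b) atTop
      (nhds 1) := by
  have h := (tendsto_Gamma_div_factorial hb).div (tendsto_Gamma_div_factorial hs) one_ne_zero
  rw [div_one] at h
  refine h.congr' ?_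
  filter_upwards [eventually_gt_atTop 0] with n hn
  have hn' : (0 : ℝ) < n := by exact_mod_cast hn
  have hf : (n.factorial : ℝ) ≠ 0 := by positivity
  have hp : (n : ℝ) ^ (s - 1) ≠ 0 := (rpow_pos_of_pos hn' _).ne'
  have hg : Gamma (n + s) ≠ 0 := (Gamma_pos_of_pos (by positivity)).ne'
  simp only [Pi.div_apply]
  rw [show s + b - 1 = (s - 1) + b by ring, rpow_add hn']
  have hp' : (n : ℝ) ^ b ≠ 0 := (rpow_pos_of_pos hn' _).ne'
  field_simp

/-- The ratio of Gamma functions at arguments growing like `δ / e` behaves like a power. -/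
theorem tendsto_rpow_mul_Gamma_shift_div {s b δ : ℝ} (hs : 0 < s) (hb : 0 < s + b) (hδ : 0 < δ)
    {e : ℕ → ℝ} (he : ∀ n, 0 < e n) {d : ℕ → ℕ} (hd : Tendsto d atTop atTop)
    (hed : Tendsto (fun n => e n * (d n : ℝ)) atTop (nhds δ)) :
    Tendsto (fun n => e n ^ b * (Gamma (d n + (s + b)) / Gamma (d n + s))) atTop
      (nhds (δ ^ b)) := by
  have h1 := (tendsto_Gamma_shift_div hs hb).comp hd
  have h2 := hed.rpow_const (p := b) (Or.inl hδ.ne')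
  have h3 := h2.mul h1
  rw [mul_one] at h3
  refine h3.congr' ?_
  filter_upwards [hd.eventually_gt_atTop 0] with n hn
  have hn' : (0 : ℝ) < d n := by exact_mod_cast hn
  have hp' : (d n : ℝ) ^ b ≠ 0 := (rpow_pos_of_pos hn' _).ne'
  simp only [Function.comp]
  rw [mul_rpow (he n).le hn'.le]
  field_simp

theorem abs_mul_log_one_add_sub_le {u : ℝ} (hu : |u| ≤ 1 / 2) :
    |(1 + u) * log (1 + u) - u - u ^ 2 / 2| ≤ 4 * |u| ^ 3 := by
  have h := abs_log_sub_add_sum_range_le (x := -u) (by rw [abs_neg]; linarith) 2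
  rw [abs_neg, sub_neg_eq_add] at h
  norm_num [Finset.sum_range_succ] at h
  have h1 : |u| ^ 3 / (1 - |u|) ≤ 2 * |u| ^ 3 := by
    rw [div_le_iff₀ (by linarith)]
    have : 0 ≤ |u| ^ 3 := by positivity
    nlinarith
  have h2 : (1 + u) * log (1 + u) - u - u ^ 2 / 2 =
      (1 + u) * (-u + u ^ 2 / 2 + log (1 + u)) - u ^ 3 / 2 := by ring
  have h3 : |1 + u| ≤ 3 / 2 := by
    rw [abs_le] at hu ⊢
    constructor <;> linarith
  rw [h2]
  calc |(1 + u) * (-u + u ^ 2 / 2 + log (1 + u)) - u ^ 3 / 2|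
      ≤ |(1 + u) * (-u + u ^ 2 / 2 + log (1 + u))| + |u ^ 3 / 2| := abs_sub _ _
    _ = |1 + u| * |-u + u ^ 2 / 2 + log (1 + u)| + |u| ^ 3 / 2 := by
        rw [abs_mul, abs_div, abs_pow, abs_of_pos (show (0 : ℝ) < 2 by norm_num)]
    _ ≤ 3 / 2 * (2 * |u| ^ 3) + |u| ^ 3 / 2 := by
        gcongr
        exact h.trans h1
    _ ≤ 4 * |u| ^ 3 := by
        have : 0 ≤ |u| ^ 3 := by positivity
        linarith

theorem tendsto_mul_of_rpow_half_mul_sub {t y : ℝ} {e : ℕ → ℝ} (he : ∀ n, 0 < e n)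
    (he0 : Tendsto e atTop (nhds 0)) {k : ℕ → ℕ}
    (hk : Tendsto (fun n => e n ^ ((1 : ℝ) / 2) * ((k n : ℝ) - t / e n)) atTop (nhds y)) :
    Tendsto (fun n => e n * (k n : ℝ)) atTop (nhds t) := by
  have h1 : Tendsto (fun n => e n ^ ((1 : ℝ) / 2)) atTop (nhds 0) := by
    have := he0.rpow_const (p := (1 : ℝ) / 2) (Or.inr (by norm_num))
    rwa [zero_rpow (by norm_num)] at this
  have h2 := (h1.mul hk).const_add t
  rw [zero_mul, add_zero] at h2
  refine h2.congr fun n => ?_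
  have hn := he n
  rw [← mul_assoc, ← rpow_add hn]
  norm_num
  field_simp
  ring

theorem tendsto_atTop_of_mul {δ : ℝ} (hδ : 0 < δ) {e : ℕ → ℝ} (he : ∀ n, 0 < e n)
    (he0 : Tendsto e atTop (nhds 0)) {k : ℕ → ℕ}
    (hk : Tendsto (fun n => e n * (k n : ℝ)) atTop (nhds δ)) : Tendsto k atTop atTop := by
  rw [← tendsto_natCast_atTop_iff (R := ℝ)]
  have h1 : Tendsto (fun n => (e n)⁻¹) atTop atTop :=
    (tendsto_nhdsWithin_iff.2 ⟨he0, Eventually.of_forall he⟩).inv_tendsto_nhdsGT_zero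
  refine (hk.pos_mul_atTop hδ h1).congr fun n => ?_
  have := (he n).ne'
  field_simp

theorem tendsto_poisson_exponent {t y : ℝ} (ht : 0 < t) {e : ℕ → ℝ} (he : ∀ n, 0 < e n)
    (he0 : Tendsto e atTop (nhds 0)) {k : ℕ → ℕ}
    (hk : Tendsto (fun n => e n ^ ((1 : ℝ) / 2) * ((k n : ℝ) - t / e n)) atTop (nhds y)) :
    Tendsto (fun n => (k n : ℝ) - t / e n - k n * log (e n * k n / t)) atTop
      (nhds (-y ^ 2 / (2 * t))) := by
  set u : ℕ → ℝ := fun n => e n * k n / t - 1 with hu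
  have hu0 : Tendsto u atTop (nhds 0) := by
    have := ((tendsto_mul_of_rpow_half_mul_sub he he0 hk).div_const t).sub_const 1
    rwa [div_self ht.ne', sub_self] at this
  have hsq : Tendsto (fun n => t / e n * u n ^ 2) atTop (nhds (y ^ 2 / t)) := by
    refine ((hk.pow 2).div_const t).congr fun n => ?_
    have hn := he n
    have : (e n ^ ((1 : ℝ) / 2)) ^ 2 = e n := by
      rw [← rpow_natCast, ← rpow_mul hn.le]
      norm_num
    rw [mul_pow, this, hu]
    field_simp
  have hrem : Tendsto (fun n => t / e n * ((1 + u n) * log (1 + u n) - u n - u n ^ 2 / 2)) atTop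
      (nhds 0) := by
    have hb := hsq.mul (hu0.abs.const_mul 4)
    rw [abs_zero, mul_zero, mul_zero] at hb
    refine squeeze_zero_norm' ?_ hb
    have hsmall : ∀ᶠ n in atTop, |u n| ≤ 1 / 2 := by
      have := hu0.abs
      rw [abs_zero] at this
      exact this.eventually_le_const (by norm_num)
    filter_upwards [hsmall] with n hn
    have hpos : 0 < t / e n := div_pos ht (he n)
    rw [norm_eq_abs, abs_mul, abs_of_pos hpos, mul_assoc]
    refine mul_le_mul_of_nonneg_left ?_ hpos.le
    calc _ ≤ 4 * |u n| ^ 3 := abs_mul_log_one_add_sub_le hn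
      _ = u n ^ 2 * (4 * |u n|) := by rw [← sq_abs]; ring
  have h := ((hsq.div_const 2).add hrem).neg
  rw [add_zero] at h
  have hlim : -(y ^ 2 / t / 2) = -y ^ 2 / (2 * t) := by field_simp
  rw [hlim] at h
  refine h.congr fun n => ?_
  have hn := (he n).ne'
  have h1 : 1 + u n = e n * k n / t := by rw [hu]; ring
  rw [h1]
  simp only [hu]
  field_simp
  ring

/-- Local limit theorem for the Poisson distribution of parameter `t / e` as `e → 0⁺`. -/
theorem tendsto_poisson_local {t y : ℝ} (ht : 0 < t) {e : ℕ → ℝ} (he : ∀ n, 0 < e n)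
    (he0 : Tendsto e atTop (nhds 0)) {k : ℕ → ℕ}
    (hk : Tendsto (fun n => e n ^ ((1 : ℝ) / 2) * ((k n : ℝ) - t / e n)) atTop (nhds y)) :
    Tendsto (fun n => e n ^ (-(1 : ℝ) / 2) *
        (exp (-(t / e n)) * (t / e n) ^ k n / ((k n).factorial : ℝ))) atTop
      (nhds (t ^ (-(1 : ℝ) / 2) * (2 * π) ^ (-(1 : ℝ) / 2) * exp (-y ^ 2 / (2 * t)))) := by
  have hek := tendsto_mul_of_rpow_half_mul_sub he he0 hk
  have hkt := tendsto_atTop_of_mul ht he he0 hek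
  have hst : Tendsto (fun n : ℕ => √(2 * n * π) * (n / exp 1) ^ n / (n.factorial : ℝ)) atTop
      (nhds 1) := by
    have h := Stirling.factorial_isEquivalent_stirling.symm
    rwa [Asymptotics.isEquivalent_iff_tendsto_one] at h
    exact Eventually.of_forall fun n => by positivity
  have h1 := ((hek.rpow_const (p := -(1 : ℝ) / 2) (Or.inl ht.ne')).mul_const
    ((2 * π) ^ (-(1 : ℝ) / 2))).mul
    ((continuous_exp.tendsto _).comp (tendsto_poisson_exponent ht he he0 hk))
  have h2 := h1.mul (hst.comp hkt)
  rw [mul_one] at h2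
  refine h2.congr' ?_
  filter_upwards [hkt.eventually_gt_atTop 0] with n hn
  have hn' : (0 : ℝ) < k n := by exact_mod_cast hn
  have hen := he n
  have hfac : ((k n).factorial : ℝ) ≠ 0 := by positivity
  have hsqrt : √(2 * k n * π) = (k n : ℝ) ^ ((1 : ℝ) / 2) * (2 * π) ^ ((1 : ℝ) / 2) := by
    rw [sqrt_eq_rpow, ← mul_rpow hn'.le (by positivity)]
    congr 1
    ring
  have hlog : exp (k n * log (e n * k n / t)) = (e n * k n / t) ^ k n := by
    rw [exp_nat_mul, exp_log (by positivity)]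
  have hek' : exp (k n : ℝ) = exp 1 ^ k n := by rw [← exp_nat_mul, mul_one]
  simp only [Function.comp]
  rw [hsqrt, exp_sub, exp_sub, hlog, mul_rpow hen.le hn'.le, hek', exp_neg]
  have r1 : ∀ x : ℝ, 0 < x → x ^ (-(1 : ℝ) / 2) * x ^ ((1 : ℝ) / 2) = 1 := by
    intro x hx
    rw [← rpow_add hx]
    norm_num
  have hkk := r1 _ hn'
  have hpp := r1 (2 * π) (by positivity)
  have hp1 : exp 1 ^ k n ≠ 0 := by positivity
  have hp2 : exp (t / e n) ≠ 0 := by positivity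
  calc _ = (e n ^ (-(1 : ℝ) / 2) * (exp (t / e n))⁻¹ / (k n).factorial) *
        ((k n : ℝ) ^ (-(1 : ℝ) / 2) * (k n : ℝ) ^ ((1 : ℝ) / 2)) *
        ((2 * π) ^ (-(1 : ℝ) / 2) * (2 * π) ^ ((1 : ℝ) / 2)) *
        (exp 1 ^ k n / (e n * k n / t) ^ k n * (k n / exp 1) ^ k n) := by ring
    _ = _ := by
        rw [hkk, hpp, ← div_pow, ← mul_pow]
        have : exp 1 / (e n * k n / t) * (k n / exp 1) = t / e n := by field_simp
        rw [this]
        ring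

theorem prod_hook_row_eq_div {N : ℕ} {lam : Fin N → ℕ} (hlam : Antitone lam) {θ c : ℝ}
    (hθ : 0 < θ) (hc : 0 < c) (i : Fin N) :
    ∏ j ∈ Finset.range (lam i),
      ((lam i : ℝ) - ((j : ℝ) + 1) +
        θ * ((transposeCount lam (j + 1) : ℝ) - ((i : ℝ) + 1)) + c) =
      Gamma ((lam i : ℝ) + θ * ((N : ℝ) - 1 - i) + c) / Gamma c /
        ∏ k ∈ Finset.Ioi i,
          Gamma (((lam i - lam k : ℕ) : ℝ) + (θ * ((k : ℝ) - 1 - i) + c + θ)) /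
            Gamma (((lam i - lam k : ℕ) : ℝ) + (θ * ((k : ℝ) - 1 - i) + c)) := by
  rw [prod_hook_row hlam hθ hc i, div_eq_mul_inv (_ / _), ← Finset.prod_inv_distrib]
  congr 1
  refine Finset.prod_congr rfl fun k hk => ?_
  rw [inv_div, Nat.cast_sub (hlam (Finset.mem_Ioi.1 hk).le)]
  congr 2 <;> ring

/-- The contribution of row `i` to the Jack measure weight. -/
noncomputable def rowWeight (N : ℕ) (θ t ε : ℝ) (lam : Fin N → ℕ) (i : Fin N) : ℝ :=
  exp (-(t / ε)) * (t / ε) ^ lam i / ((lam i).factorial : ℝ) *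
    (Gamma (lam i + (1 + θ * ((N : ℝ) - 1 - i))) / Gamma (lam i + 1))⁻¹ *
    (Gamma θ / Gamma (((i.rev : ℕ) + 1) * θ)) *
    ∏ k ∈ Finset.Ioi i,
      (Gamma (((lam i - lam k : ℕ) : ℝ) + (θ * ((k : ℝ) - 1 - i) + θ + θ)) /
          Gamma (((lam i - lam k : ℕ) : ℝ) + (θ * ((k : ℝ) - 1 - i) + θ)) *
        (Gamma (((lam i - lam k : ℕ) : ℝ) + (θ * ((k : ℝ) - 1 - i) + 1 + θ)) /
          Gamma (((lam i - lam k : ℕ) : ℝ) + (θ * ((k : ℝ) - 1 - i) + 1))))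

theorem Fin.cast_rev_real {N : ℕ} (i : Fin N) : ((i.rev : ℕ) : ℝ) = (N : ℝ) - 1 - i := by
  rw [Fin.val_rev, Nat.cast_sub (by omega)]
  push_cast
  ring

theorem jackWeight_eq_prod_rowWeight {N : ℕ} {θ t ε : ℝ} (hθ : 0 < θ) {lam : Fin N → ℕ}
    (hlam : Antitone lam) :
    jackWeight N θ t ε lam = ∏ i, rowWeight N θ t ε lam i := by
  have hexp : exp (-((N : ℝ) * t / ε)) = ∏ _i : Fin N, exp (-(t / ε)) := by
    rw [Finset.prod_const, Finset.card_univ, Fintype.card_fin, ← exp_nat_mul]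
    congr 1
    ring
  rw [jackWeight, hexp, ← Finset.prod_pow_eq_pow_sum, ← Finset.prod_mul_distrib,
    ← Finset.prod_mul_distrib]
  refine Finset.prod_congr rfl fun i _ => ?_
  have hrev : (0 : ℝ) ≤ (N : ℝ) - 1 - i := by
    rw [← Fin.cast_rev_real]
    positivity
  have hm := mul_nonneg hθ.le hrev
  rw [rowWeight, Finset.prod_div_distrib, Finset.prod_mul_distrib,
    prod_hook_row_eq_div hlam hθ hθ, prod_hook_row_eq_div hlam hθ one_pos,
    Finset.prod_mul_distrib]
  have hnum : ∏ j ∈ Finset.range (lam i), ((N : ℝ) * θ + (j : ℝ) - θ * (i : ℝ)) =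
      Gamma (lam i + θ * ((N : ℝ) - 1 - i) + θ) / Gamma (((i.rev : ℕ) + 1) * θ) := by
    rw [Fin.cast_rev_real]
    have h := prod_range_add_eq_Gamma_div
      (a := ((N : ℝ) - 1 - i + 1) * θ) (by positivity) (lam i)
    rw [show (lam i : ℝ) + θ * ((N : ℝ) - 1 - i) + θ = lam i + ((N : ℝ) - 1 - i + 1) * θ by ring,
      ← h]
    refine Finset.prod_congr rfl fun j _ => ?_
    ring
  rw [hnum, Gamma_one, Gamma_nat_eq_factorial,
    show (lam i : ℝ) + (1 + θ * ((N : ℝ) - 1 - i)) = lam i + θ * ((N : ℝ) - 1 - i) + 1 by ring]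
  have h1 : Gamma (lam i + θ * ((N : ℝ) - 1 - i) + θ) ≠ 0 :=
    (Gamma_pos_of_pos (by positivity)).ne'
  have h2 : ((lam i).factorial : ℝ) ≠ 0 := by positivity
  field_simp

theorem tendsto_rowWeight {N : ℕ} {θ t : ℝ} (hθ : 0 < θ) (ht : 0 < t)
    {y : Fin N → ℝ} (hy : StrictMono y)
    {ε : ℕ → ℝ} (hεpos : ∀ n, 0 < ε n) (hε0 : Tendsto ε atTop (nhds 0))
    {lam : ℕ → Fin N → ℕ} (hlam : ∀ n, Antitone (lam n))
    (hconv : ∀ i : Fin N,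
      Tendsto (fun n => (ε n) ^ ((1 : ℝ) / 2) * ((lam n i : ℝ) - t / ε n)) atTop
        (nhds (y i.rev))) (i : Fin N) :
    Tendsto (fun n => ε n ^ (-(1 : ℝ) / 2) * rowWeight N θ t (ε n) (lam n) i) atTop
      (nhds (t ^ (-(1 : ℝ) / 2) * (2 * π) ^ (-(1 : ℝ) / 2) * exp (-y i.rev ^ 2 / (2 * t)) *
        (t ^ (θ * (i.rev : ℕ)))⁻¹ * (Gamma θ / Gamma (((i.rev : ℕ) + 1) * θ)) *
        ∏ k ∈ Finset.Ioi i, (y i.rev - y k.rev) ^ (2 * θ))) := by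
  have hrev : (0 : ℝ) ≤ (N : ℝ) - 1 - i := by
    rw [← Fin.cast_rev_real]
    positivity
  have hm := mul_nonneg hθ.le hrev
  have hek := tendsto_mul_of_rpow_half_mul_sub hεpos hε0 (hconv i)
  have hkt := tendsto_atTop_of_mul ht hεpos hε0 hek
  have hfac := (tendsto_rpow_mul_Gamma_shift_div (b := θ * ((N : ℝ) - 1 - i)) one_pos
    (by positivity) ht hεpos hkt hek).inv₀ (rpow_pos_of_pos ht _).ne'
  have he : ∀ n, 0 < ε n ^ ((1 : ℝ) / 2) := fun n => rpow_pos_of_pos (hεpos n) _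
  have he0 : Tendsto (fun n => ε n ^ ((1 : ℝ) / 2)) atTop (nhds 0) := by
    have := hε0.rpow_const (p := (1 : ℝ) / 2) (Or.inr (by norm_num))
    rwa [zero_rpow (by norm_num)] at this
  have hpair : Tendsto (fun n => ∏ k ∈ Finset.Ioi i,
      ((ε n ^ ((1 : ℝ) / 2)) ^ θ *
        (Gamma (((lam n i - lam n k : ℕ) : ℝ) + (θ * ((k : ℝ) - 1 - i) + θ + θ)) /
          Gamma (((lam n i - lam n k : ℕ) : ℝ) + (θ * ((k : ℝ) - 1 - i) + θ))) *
        ((ε n ^ ((1 : ℝ) / 2)) ^ θ *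
        (Gamma (((lam n i - lam n k : ℕ) : ℝ) + (θ * ((k : ℝ) - 1 - i) + 1 + θ)) /
          Gamma (((lam n i - lam n k : ℕ) : ℝ) + (θ * ((k : ℝ) - 1 - i) + 1)))))) atTop
      (nhds (∏ k ∈ Finset.Ioi i, (y i.rev - y k.rev) ^ (2 * θ))) := by
    refine tendsto_finsetProd _ fun k hk => ?_
    have hik := Finset.mem_Ioi.1 hk
    have hδ : 0 < y i.rev - y k.rev := sub_pos.2 (hy (Fin.rev_lt_rev.2 hik))
    have hd : Tendsto (fun n => ε n ^ ((1 : ℝ) / 2) * ((lam n i - lam n k : ℕ) : ℝ)) atTop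
        (nhds (y i.rev - y k.rev)) := by
      refine ((hconv i).sub (hconv k)).congr fun n => ?_
      rw [Nat.cast_sub (hlam n hik.le)]
      ring
    have hdt := tendsto_atTop_of_mul hδ he he0 hd
    have hki : (0 : ℝ) ≤ (k : ℝ) - 1 - i := by
      have : (i : ℝ) + 1 ≤ k := by exact_mod_cast hik
      linarith
    have hmk := mul_nonneg hθ.le hki
    rw [two_mul, rpow_add hδ]
    exact (tendsto_rpow_mul_Gamma_shift_div (b := θ) (by positivity) (by positivity)
      hδ he hdt hd).mul (tendsto_rpow_mul_Gamma_shift_div (b := θ) (by positivity)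
      (by positivity) hδ he hdt hd)
  have h := (((tendsto_poisson_local ht hεpos hε0 (hconv i)).mul hfac).mul_const
    (Gamma θ / Gamma (((i.rev : ℕ) + 1) * θ))).mul hpair
  rw [← Fin.cast_rev_real] at h
  refine h.congr fun n => ?_
  have hcard : ∏ _k ∈ Finset.Ioi i, ((ε n ^ ((1 : ℝ) / 2)) ^ θ * (ε n ^ ((1 : ℝ) / 2)) ^ θ) =
      ε n ^ (θ * (i.rev : ℕ)) := by
    rw [Finset.prod_const, Fin.card_Ioi, show N - 1 - (i : ℕ) = (i.rev : ℕ) by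
      rw [Fin.val_rev]; omega, ← mul_rpow (he n).le (he n).le, ← rpow_add (hεpos n),
      rpow_mul (hεpos n).le, rpow_natCast]
    norm_num
  have hpow : ε n ^ (θ * (i.rev : ℕ)) ≠ 0 := (rpow_pos_of_pos (hεpos n) _).ne'
  simp only [mul_mul_mul_comm ((ε n ^ ((1 : ℝ) / 2)) ^ θ)]
  rw [Finset.prod_mul_distrib, hcard, rowWeight, mul_inv, ← Fin.cast_rev_real]
  field_simp

/-- **Diffusive limit of the Jack measure weights** (fixed-time convergence to the Hermite β
ensemble density): if `ε_n → 0⁺` and the partitions `λ(n)` (with at most `N` rows) satisfy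
`ε_n^{1/2}(λ_i(n) − t/ε_n) → y_{N+1−i}`, then
`ε_n^{−N/2} W_{ε_n}(λ(n)) → (1/Z) ∏_{i<j}(y_j−y_i)^{2θ} ∏_i exp(−y_i²/(2t))`. -/
theorem jack_weight_fixed_time_limit (N : ℕ) (hN : 1 ≤ N) (θ t : ℝ) (hθ : 0 < θ) (ht : 0 < t)
    (y : Fin N → ℝ) (hy : StrictMono y)
    (ε : ℕ → ℝ) (hεpos : ∀ n, 0 < ε n) (hε0 : Tendsto ε atTop (nhds 0))
    (lam : ℕ → Fin N → ℕ) (hlam : ∀ n, Antitone (lam n))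
    (hconv : ∀ i : Fin N,
      Tendsto (fun n => (ε n) ^ ((1 : ℝ) / 2) * ((lam n i : ℝ) - t / ε n)) atTop
        (nhds (y i.rev))) :
    Tendsto (fun n => (ε n) ^ (-(N : ℝ) / 2) * jackWeight N θ t (ε n) (lam n)) atTop
      (nhds
        ((1 / (t ^ (θ * N * ((N : ℝ) - 1) / 2 + N / 2) * (2 * Real.pi) ^ ((N : ℝ) / 2) *
            ∏ j : Fin N, Real.Gamma (((j : ℕ) + 1) * θ) / Real.Gamma θ)) *
          (∏ j : Fin N, ∏ i ∈ Finset.Iio j, (y j - y i) ^ (2 * θ)) *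
          ∏ i : Fin N, Real.exp (-(y i) ^ 2 / (2 * t)))) := by
  have hlim := tendsto_finsetProd Finset.univ fun i (_ : i ∈ Finset.univ) =>
    tendsto_rowWeight hθ ht hy hεpos hε0 hlam hconv i
  have heq : ∀ n, ∏ i, (ε n ^ (-(1 : ℝ) / 2) * rowWeight N θ t (ε n) (lam n) i) =
      ε n ^ (-(N : ℝ) / 2) * jackWeight N θ t (ε n) (lam n) := by
    intro n
    rw [Finset.prod_mul_distrib, ← jackWeight_eq_prod_rowWeight hθ (hlam n), Finset.prod_const,
      Finset.card_univ, Fintype.card_fin, ← rpow_mul_natCast (hεpos n).le]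
    congr 2
    ring
  simp only [heq] at hlim
  convert hlim using 2
  have hprod : ∀ i : Fin N, ∏ k ∈ Finset.Ioi i, (y i.rev - y k.rev) ^ (2 * θ) =
      ∏ k ∈ Finset.Iio i.rev, (y i.rev - y k) ^ (2 * θ) := by
    intro i
    refine Finset.prod_nbij' Fin.rev Fin.rev ?_ ?_ ?_ ?_ ?_
    · intro k hk
      simpa using hk
    · intro k hk
      rw [Finset.mem_Ioi, Fin.lt_rev_iff]
      simpa using hk
    · simp
    · simp
    · simp
  simp only [hprod]
  rw [← Equiv.prod_comp Fin.revPerm (fun j : Fin N => ∏ i ∈ Finset.Iio j, (y j - y i) ^ (2 * θ)),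
    ← Equiv.prod_comp Fin.revPerm (fun j : Fin N => exp (-(y j) ^ 2 / (2 * t))),
    ← Equiv.prod_comp Fin.revPerm (fun j : Fin N => Gamma (((j : ℕ) + 1) * θ) / Gamma θ)]
  simp only [Fin.revPerm_apply, Finset.prod_mul_distrib]
  have hsum : ∑ i : Fin N, ((i.rev : ℕ) : ℝ) = N * ((N : ℝ) - 1) / 2 := by
    refine (Equiv.sum_comp Fin.revPerm (fun j : Fin N => ((j : ℕ) : ℝ))).trans ?_
    rw [Fin.sum_univ_eq_sum_range (fun j : ℕ => (j : ℝ)) N]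
    clear * -
    induction N with
    | zero => simp
    | succ n ih =>
      rw [Finset.sum_range_succ, ih]
      push_cast
      ring
  have ht1 : ∏ i : Fin N, (t ^ (θ * (i.rev : ℕ)))⁻¹ = (t ^ (θ * N * ((N : ℝ) - 1) / 2))⁻¹ := by
    rw [Finset.prod_inv_distrib, ← rpow_sum_of_pos ht, ← Finset.mul_sum, hsum]
    congr 2
    ring
  have ht2 : ∀ x : ℝ, 0 < x → ∏ _i : Fin N, x ^ (-(1 : ℝ) / 2) = (x ^ ((N : ℝ) / 2))⁻¹ := by
    intro x hx
    rw [Finset.prod_const, Finset.card_univ, Fintype.card_fin, ← rpow_mul_natCast hx.le,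
      ← rpow_neg hx.le]
    congr 1
    ring
  have hG : ∏ i : Fin N, Gamma θ / Gamma (((i.rev : ℕ) + 1) * θ) =
      (∏ i : Fin N, Gamma (((i.rev : ℕ) + 1) * θ) / Gamma θ)⁻¹ := by
    rw [← Finset.prod_inv_distrib]
    simp only [inv_div]
  rw [ht1, ht2 t ht, ht2 (2 * π) (by positivity), hG, rpow_add ht, one_div, mul_inv, mul_inv,
    mul_inv]
  ring
end
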